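/- Let G be a finite group, A a normal abelian subgroup of G, and b an element of G with b ∉ A, b² = 1, b⁻¹ab = a⁻¹ for every a ∈ A, and such that G is generated by A together with b (so G = A ⋊ ⟨b⟩ is a generalized dihedral group). Then a subgroup H of G is a perfect code of G if and only if either H is not contained in A, or H (regarded as a subgroup of A) is a perfect code of A. -/

import Mathlib

/-- A subgroup `H` of a finite group `G` is a *perfect code* of `G` if there exists a subset
`T` of `G` that is inverse-closed and is a right transversal of `H` in `G` (i.e., every element
of `G` can be written uniquely as `h * t` with `h ∈ H` and `t ∈ T`). -/
def Subgroup.IsPerfectCode {G : Type*} [Group G] (H : Subgroup G) : Prop :=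
  ∃ T : Set G, T⁻¹ = T ∧ Subgroup.IsComplement (H : Set G) T

namespace Subgroup

variable {G : Type*} [Group G] {A : Subgroup G} {b : G}

/-- `H` is a perfect code as soon as every right coset of `H` contains a self-inverse element. -/
theorem isPerfectCode_of_forall_exists_inv_eq_self {H : Subgroup G}
    (h : ∀ g : G, ∃ t : G, t⁻¹ = t ∧ t * g⁻¹ ∈ H) : H.IsPerfectCode := by
  choose f hf_inv hf_mem using h
  let s : Quotient (QuotientGroup.rightRel H) → G := fun q => f q.out
  have hs : ∀ q, Quotient.mk'' (s q) = q := fun q => by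
    conv_rhs => rw [← Quotient.out_eq' q]
    rw [Quotient.eq'', QuotientGroup.rightRel_apply]
    simpa [s] using H.inv_mem (hf_mem q.out)
  refine ⟨Set.range s, ?_, isComplement_range_right hs⟩
  ext x
  rw [Set.mem_inv]
  constructor
  · rintro ⟨q, hq⟩
    exact ⟨q, by rw [← inv_inj, ← hq, hf_inv]⟩
  · rintro ⟨q, rfl⟩
    exact ⟨q, (hf_inv _).symm⟩

theorem exists_mul_eq_of_notMem_of_sup_zpowers_eq_top [A.Normal] (hb2 : b ^ 2 = 1)
    (hgen : A ⊔ zpowers b = ⊤) {g : G} (hg : g ∉ A) : ∃ a ∈ A, a * b = g := by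
  have hg_mem : g ∈ A ⊔ zpowers b := hgen ▸ mem_top g
  obtain ⟨a, ha, _, ⟨k, rfl⟩, rfl⟩ := mem_sup_of_normal_left.mp hg_mem
  have hb2' : b ^ (2 : ℤ) = 1 := mod_cast hb2
  obtain ⟨m, rfl | rfl⟩ := Int.even_or_odd' k
  · simp [zpow_mul, hb2', ha] at hg
  · exact ⟨a, ha, by simp [zpow_add, zpow_mul, hb2']⟩

theorem inv_eq_self_of_mul_of_conj_eq_inv (hb2 : b ^ 2 = 1) {a : G} (h : b⁻¹ * a * b = a⁻¹) :
    (a * b)⁻¹ = a * b := by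
  have hb : b⁻¹ = b := inv_eq_of_mul_eq_one_left (by rw [← sq, hb2])
  rw [mul_inv_rev, ← h, hb]
  simp [← mul_assoc, ← sq, hb2]

theorem IsPerfectCode.subgroupOf {H : Subgroup G} (hHA : H ≤ A) (h : H.IsPerfectCode) :
    (H.subgroupOf A).IsPerfectCode := by
  obtain ⟨T, hT_inv, hT⟩ := h
  rw [isComplement_iff_existsUnique_mul_inv_mem] at hT
  refine ⟨{a : A | (a : G) ∈ T}, ?_, ?_⟩
  · ext a
    have : ((a : G)⁻¹ ∈ T) ↔ (a : G) ∈ T := by rw [← Set.mem_inv, hT_inv]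
    simpa using this
  · rw [isComplement_iff_existsUnique_mul_inv_mem]
    intro a
    obtain ⟨⟨t, ht⟩, hat, huniq⟩ := hT a
    have htA : t ∈ A := by simpa using A.mul_mem (A.inv_mem (hHA hat)) a.2
    refine ⟨⟨⟨t, htA⟩, ht⟩, hat, ?_⟩
    rintro ⟨⟨u, huA⟩, hu⟩ hau
    have := huniq ⟨u, hu⟩ hau
    simpa using this

end Subgroup

theorem generalized_dihedral_isPerfectCode_iff {G : Type*} [Group G] [Finite G]
    (A : Subgroup G) [A.Normal]
    (hA : ∀ a ∈ A, ∀ c ∈ A, a * c = c * a)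
    (b : G) (hbA : b ∉ A) (hb2 : b ^ 2 = 1)
    (hconj : ∀ a ∈ A, b⁻¹ * a * b = a⁻¹)
    (hgen : A ⊔ Subgroup.zpowers b = ⊤)
    (H : Subgroup G) :
    H.IsPerfectCode ↔ (¬ H ≤ A ∨ (H.subgroupOf A).IsPerfectCode) := by
  have hmul {g : G} (hg : g ∉ A) : ∃ a ∈ A, a * b = g :=
    Subgroup.exists_mul_eq_of_notMem_of_sup_zpowers_eq_top hb2 hgen hg
  have hinv {g : G} (hg : g ∉ A) : g⁻¹ = g := by
    obtain ⟨a, ha, rfl⟩ := hmul hg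
    exact Subgroup.inv_eq_self_of_mul_of_conj_eq_inv hb2 (hconj a ha)
  by_cases hHA : H ≤ A
  · simp only [hHA, not_true_eq_false, false_or]
    refine ⟨fun h => h.subgroupOf hHA, ?_⟩
    rintro ⟨T, hT_inv, hT⟩
    rw [Subgroup.isComplement_iff_existsUnique_mul_inv_mem] at hT
    have hT_inv_mem (t : A) (ht : t ∈ T) : t⁻¹ ∈ T := by rwa [← Set.mem_inv, hT_inv]
    have hmem_iff {g t : G} (h : g * t⁻¹ ∈ H) : t ∈ A ↔ g ∈ A := by
      rw [← A.mul_mem_cancel_left (hHA h), inv_mul_cancel_right]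
    have hnotMem {a : A} : (a : G) * b ∉ A := by rwa [A.mul_mem_cancel_left a.2]
    refine ⟨{g | ∃ t ∈ T, (t : G) = g ∨ (t : G) * b = g}, ?_, ?_⟩
    · have hsub : {g | ∃ t ∈ T, (t : G) = g ∨ (t : G) * b = g}⁻¹ ⊆
          {g | ∃ t ∈ T, (t : G) = g ∨ (t : G) * b = g} := by
        rintro g ⟨t, ht, h | h⟩
        · exact ⟨t⁻¹, hT_inv_mem t ht, .inl (by simp [h])⟩
        · exact ⟨t, ht, .inr (by rw [← inv_inj, hinv hnotMem, h])⟩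
      exact hsub.antisymm (Set.inv_subset.mp hsub)
    · rw [Subgroup.isComplement_iff_existsUnique_mul_inv_mem]
      intro g
      by_cases hg : g ∈ A
      · obtain ⟨⟨t, ht⟩, hgt, huniq⟩ := hT ⟨g, hg⟩
        refine ⟨⟨t, t, ht, .inl rfl⟩, hgt, ?_⟩
        rintro ⟨_, u, hu, rfl | rfl⟩ hgu
        · have := huniq ⟨u, hu⟩ hgu
          simpa using this
        · exact absurd ((hmem_iff hgu).mpr hg) hnotMem
      · obtain ⟨a, ha, rfl⟩ := hmul hg
        obtain ⟨⟨t, ht⟩, hat, huniq⟩ := hT ⟨a, ha⟩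
        refine ⟨⟨t * b, t, ht, .inr rfl⟩, ?_, ?_⟩
        · simpa [mul_assoc, Subgroup.mem_subgroupOf] using hat
        rintro ⟨_, u, hu, rfl | rfl⟩ hau
        · exact absurd ((hmem_iff hau).mp u.2) hg
        · have := huniq ⟨u, hu⟩ (by simpa [mul_assoc, Subgroup.mem_subgroupOf] using hau)
          simpa using this
  · simp only [hHA, not_false_eq_true, true_or, iff_true]
    obtain ⟨h, hhH, hhA⟩ := SetLike.not_le_iff_exists.mp hHA
    refine Subgroup.isPerfectCode_of_forall_exists_inv_eq_self fun g => ?_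
    by_cases hg : g ∈ A
    · exact ⟨h * g, hinv (by rwa [A.mul_mem_cancel_right hg]), by simpa using hhH⟩
    · exact ⟨g, hinv hg, by simp⟩
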